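/- arXiv:1803.06398 — 4 statements merged into one kernel-verified Lean document; each statement's English description precedes it below -/
import Mathlib

section
/- For every integer n ≥ 1, the recursive relation ≤! on Z_{n!} is a linear order: it is reflexive, transitive, antisymmetric, and any two elements of Z_{n!} are comparable. -/
/-- The recursive order `≤!` on `Z_{n!}`, expressed on indices: `recLE n k l` means
`-k/n! ≤! -l/n!`.  On `Z_{1!} = {0}` it is trivial; for `n ≥ 2`, `-k/n! ≤! -l/n!` iff
`k mod n > l mod n`, or `k ≡ l (mod n)` and `-⌊k/n⌋/(n-1)! ≤! -⌊l/n⌋/(n-1)!`. -/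
def recLE : ℕ → ℕ → ℕ → Prop
  | 0, _, _ => True
  | 1, _, _ => True
  | (n + 2), k, l =>
      l % (n + 2) < k % (n + 2) ∨
      (k % (n + 2) = l % (n + 2) ∧ recLE (n + 1) (k / (n + 2)) (l / (n + 2)))

theorem recLE_refl (n k : ℕ) : recLE n k k := by
  induction n generalizing k with
  | zero => simp [recLE]
  | succ n ih =>
    cases n with
    | zero => simp [recLE]
    | succ n => exact Or.inr ⟨rfl, ih _⟩

theorem recLE_trans {n k l m : ℕ} (hkl : recLE n k l) (hlm : recLE n l m) : recLE n k m := by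
  induction n generalizing k l m with
  | zero => simp [recLE]
  | succ n ih =>
    cases n with
    | zero => simp [recLE]
    | succ n =>
      rcases hkl with h | ⟨h, h'⟩ <;> rcases hlm with g | ⟨g, g'⟩
      · exact Or.inl (g.trans h)
      · exact Or.inl (g ▸ h)
      · exact Or.inl (h ▸ g)
      · exact Or.inr ⟨h.trans g, ih h' g'⟩

theorem recLE_total (n k l : ℕ) : recLE n k l ∨ recLE n l k := by
  induction n generalizing k l with
  | zero => simp [recLE]
  | succ n ih =>
    cases n with
    | zero => simp [recLE]
    | succ n =>
      rcases lt_trichotomy (k % (n + 2)) (l % (n + 2)) with h | h | h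
      · exact Or.inr (Or.inl h)
      · exact (ih (k / (n + 2)) (l / (n + 2))).imp
          (fun g => Or.inr ⟨h, g⟩) (fun g => Or.inr ⟨h.symm, g⟩)
      · exact Or.inl (Or.inl h)

theorem recLE_antisymm {n k l : ℕ} (hk : k < n.factorial) (hl : l < n.factorial)
    (hkl : recLE n k l) (hlk : recLE n l k) : k = l := by
  induction n generalizing k l with
  | zero => simp only [Nat.factorial_zero] at hk hl; omega
  | succ n ih =>
    cases n with
    | zero => simp only [zero_add, Nat.factorial_one] at hk hl; omega
    | succ n =>
      rcases hkl with h | ⟨h, h'⟩ <;> rcases hlk with g | ⟨g, g'⟩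
      · exact absurd h g.asymm
      · exact absurd g h.ne
      · exact absurd h g.ne
      · rw [Nat.factorial_succ] at hk hl
        have hq := ih (Nat.div_lt_of_lt_mul hk) (Nat.div_lt_of_lt_mul hl) h' g'
        rw [← Nat.div_add_mod k (n + 2), ← Nat.div_add_mod l (n + 2), hq, h]

theorem stmt3 (n : ℕ) (hn : 1 ≤ n) :
    -- reflexive
    (∀ k : ℕ, k < n.factorial → recLE n k k) ∧
    -- transitive
    (∀ k l m : ℕ, k < n.factorial → l < n.factorial → m < n.factorial →
      recLE n k l → recLE n l m → recLE n k m) ∧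
    -- antisymmetric
    (∀ k l : ℕ, k < n.factorial → l < n.factorial →
      recLE n k l → recLE n l k → k = l) ∧
    -- total
    (∀ k l : ℕ, k < n.factorial → l < n.factorial → recLE n k l ∨ recLE n l k) := by
  exact ⟨fun k _ => recLE_refl n k, fun _ _ _ _ _ _ => recLE_trans,
    fun _ _ => recLE_antisymm, fun k l _ _ => recLE_total n k l⟩
end

section
/- Let P be a finitely generated additive submonoid of ℚ^d that is simplicial of full rank. Then there exists an additive submonoid F of ℚ^d such that: (i) P ⊆ F; (ii) F is free, i.e. generated by d ℚ-linearly independent vectors; (iii) the extension P ⊆ F is Kummer, i.e. every element of F has a positive integer multiple lying in P; and (iv) F is minimal with these properties: every additive submonoid N of ℚ^d satisfying (i)–(iii) in place of F contains F. In particular such a minimal free Kummer extension F of P is unique. -/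
/-- A submonoid of `ℚ^d` is free (of rank `d`) if it is generated by `d`
`ℚ`-linearly independent vectors. -/
def IsFreeRank (d : ℕ) (F : AddSubmonoid (Fin d → ℚ)) : Prop :=
  ∃ v : Fin d → (Fin d → ℚ), LinearIndependent ℚ v ∧
    F = AddSubmonoid.closure (Set.range v)

/-- An extension `P ⊆ F` of submonoids of `ℚ^d` is Kummer if every element of `F`
has a positive integer multiple lying in `P`. -/
def IsKummer {d : ℕ} (P F : AddSubmonoid (Fin d → ℚ)) : Prop :=
  ∀ x ∈ F, ∃ k : ℕ, 0 < k ∧ k • x ∈ P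

/-- A submonoid `P` of `ℚ^d` is simplicial of full rank if there are `ℚ`-linearly
independent vectors `p_1, …, p_d ∈ P` such that every element of `P` is a nonnegative
rational linear combination of the `p_j`. -/
def IsSimplicialFullRank (d : ℕ) (P : AddSubmonoid (Fin d → ℚ)) : Prop :=
  ∃ p : Fin d → (Fin d → ℚ), LinearIndependent ℚ p ∧ (∀ j, p j ∈ P) ∧
    ∀ x ∈ P, ∃ c : Fin d → ℚ, (∀ j, 0 ≤ c j) ∧ x = ∑ j, c j • p j

theorem exists_pos_span_int_singleton (M : Submodule ℤ ℚ) (hM : M.FG) (h1 : (1 : ℚ) ∈ M) :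
    ∃ g : ℚ, 0 < g ∧ M = Submodule.span ℤ {g} := by
  have hfrac : IsFractional (nonZeroDivisors ℤ) M := FractionalIdeal.isFractional_of_fg hM
  have hp : M.IsPrincipal := FractionalIdeal.isPrincipal (⟨M, hfrac⟩ :
    FractionalIdeal (nonZeroDivisors ℤ) ℚ)
  obtain ⟨g, hg⟩ := hp.principal
  have hg0 : g ≠ 0 := by
    rintro rfl
    rw [hg] at h1
    simp at h1
  rcases lt_or_gt_of_ne hg0 with h | h
  · exact ⟨-g, neg_pos.2 h, by rw [hg, ← Set.neg_singleton, Submodule.span_neg]⟩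
  · exact ⟨g, h, hg⟩

/-- The integer span of the image of a finitely generated additive submonoid under an additive
map is finitely generated. -/
theorem fg_span_int_image {A B : Type*} [AddCommGroup A] [AddCommGroup B] (f : A →+ B)
    (P : AddSubmonoid A) (hP : P.FG) : (Submodule.span ℤ (f '' P)).FG := by
  classical
  obtain ⟨S, rfl⟩ := hP
  refine ⟨S.image f, le_antisymm (Submodule.span_mono ?_) (Submodule.span_le.2 ?_)⟩
  · rw [Finset.coe_image]
    exact Set.image_mono AddSubmonoid.subset_closure
  · rintro _ ⟨x, hx, rfl⟩
    induction hx using AddSubmonoid.closure_induction with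
    | mem y hy => exact Submodule.subset_span (by simpa using ⟨y, hy, rfl⟩)
    | zero => simp
    | add y z _ _ hy hz =>
      rw [map_add]
      exact add_mem hy hz

theorem IsKummer.closure {d : ℕ} {P : AddSubmonoid (Fin d → ℚ)} {s : Set (Fin d → ℚ)}
    (h : ∀ x ∈ s, ∃ k : ℕ, 0 < k ∧ k • x ∈ P) : IsKummer P (AddSubmonoid.closure s) := by
  intro x hx
  induction hx using AddSubmonoid.closure_induction with
  | mem x hx => exact h x hx
  | zero => exact ⟨1, one_pos, by simp⟩
  | add x y _ _ ihx ihy =>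
    obtain ⟨k, hk, hkx⟩ := ihx
    obtain ⟨l, hl, hly⟩ := ihy
    refine ⟨k * l, Nat.mul_pos hk hl, ?_⟩
    rw [smul_add, mul_comm k l, mul_smul, mul_comm l k, mul_smul]
    exact add_mem (nsmul_mem hkx l) (nsmul_mem hly k)

/-- If the nonzero vectors `v i` have nonnegative coordinates in a basis `b` and `b j` is a natural
combination of the `v i`, then some `v i` is a positive multiple of `b j`. -/
theorem exists_eq_pos_smul_of_nonneg {d : ℕ} (b : Module.Basis (Fin d) ℚ (Fin d → ℚ))
    (v : Fin d → (Fin d → ℚ)) (hv0 : ∀ i, v i ≠ 0) (hv : ∀ i l, 0 ≤ b.repr (v i) l)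
    (j : Fin d) (hj : b j ∈ AddSubmonoid.closure (Set.range v)) :
    ∃ i, ∃ t : ℚ, 0 < t ∧ v i = t • b j := by
  obtain ⟨n, hn⟩ := AddSubmonoid.mem_closure_range_iff.1 hj
  rw [Finsupp.sum_fintype _ _ (by simp)] at hn
  have hco : ∀ l, ∑ i, (n i : ℚ) * b.repr (v i) l = b.repr (b j) l := by
    intro l
    rw [hn, map_sum, Finsupp.finsetSum_apply]
    refine Finset.sum_congr rfl fun i _ => ?_
    rw [map_nsmul, Finsupp.smul_apply, nsmul_eq_mul]
  obtain ⟨i, hi⟩ : ∃ i, n i ≠ 0 := by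
    by_contra! h
    exact b.ne_zero j (by rw [hn]; simp [h])
  have hz : ∀ l, l ≠ j → b.repr (v i) l = 0 := by
    intro l hl
    have h0 : ∑ i, (n i : ℚ) * b.repr (v i) l = 0 := by
      rw [hco, b.repr_self, Finsupp.single_eq_of_ne hl]
    have := (Finset.sum_eq_zero_iff_of_nonneg
      (fun i _ => mul_nonneg (Nat.cast_nonneg _) (hv i l))).1 h0 i (Finset.mem_univ i)
    simpa [hi] using this
  have hvi : v i = b.repr (v i) j • b j := by
    conv_lhs => rw [← b.sum_repr (v i)]
    exact Finset.sum_eq_single j (fun l _ hl => by rw [hz l hl, zero_smul]) (by simp)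
  refine ⟨i, _, lt_of_le_of_ne (hv i j) fun h => hv0 i ?_, hvi⟩
  rw [hvi, ← h, zero_smul]

theorem stmt11 (d : ℕ) (P : AddSubmonoid (Fin d → ℚ)) (hfg : P.FG)
    (hsimp : IsSimplicialFullRank d P) :
    ∃! F : AddSubmonoid (Fin d → ℚ),
      P ≤ F ∧ IsFreeRank d F ∧ IsKummer P F ∧
      ∀ N : AddSubmonoid (Fin d → ℚ), P ≤ N → IsFreeRank d N → IsKummer P N → F ≤ N := by
  suffices h : ∃ F : AddSubmonoid (Fin d → ℚ),
      P ≤ F ∧ IsFreeRank d F ∧ IsKummer P F ∧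
      ∀ N : AddSubmonoid (Fin d → ℚ), P ≤ N → IsFreeRank d N → IsKummer P N → F ≤ N by
    obtain ⟨F, h1, h2, h3, h4⟩ := h
    exact ⟨F, ⟨h1, h2, h3, h4⟩, fun G hG => le_antisymm (hG.2.2.2 F h1 h2 h3)
      (h4 G hG.1 hG.2.1 hG.2.2.1)⟩
  obtain ⟨p, hp, hpP, hcone⟩ := hsimp
  obtain ⟨b, rfl⟩ : ∃ b : Module.Basis (Fin d) ℚ (Fin d → ℚ), ⇑b = p :=
    ⟨basisOfLinearIndependentOfCardEqFinrank' p hp (by simp), by simp⟩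
  have hpos : ∀ x ∈ P, ∀ j, 0 ≤ b.repr x j := by
    intro x hx j
    obtain ⟨c, hc, rfl⟩ := hcone x hx
    rw [b.repr_sum_self]
    exact hc j
  have hg : ∀ j, ∃ g : ℚ, 0 < g ∧
      Submodule.span ℤ ((b.coord j).toAddMonoidHom '' P) = Submodule.span ℤ {g} := fun j =>
    exists_pos_span_int_singleton _ (fg_span_int_image _ P hfg)
      (Submodule.subset_span ⟨b j, hpP j, by simp⟩)
  choose g hg0 hg using hg
  refine ⟨AddSubmonoid.closure (Set.range fun j => g j • b j), ?_, ?_, ?_, ?_⟩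
  · intro x hx
    rw [← b.sum_repr x]
    refine sum_mem fun j _ => ?_
    have hmem : b.repr x j ∈ Submodule.span ℤ {g j} := by
      rw [← hg j]
      exact Submodule.subset_span ⟨x, hx, by simp⟩
    obtain ⟨m, hm⟩ := Submodule.mem_span_singleton.1 hmem
    have hm0 : 0 ≤ m := by
      have := hpos x hx j
      rw [← hm, zsmul_eq_mul] at this
      exact_mod_cast nonneg_of_mul_nonneg_left this (hg0 j)
    lift m to ℕ using hm0
    rw [← hm, smul_assoc, natCast_zsmul]
    exact nsmul_mem (AddSubmonoid.subset_closure (Set.mem_range_self j)) m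
  · exact ⟨_, b.linearIndependent.units_smul fun j => Units.mk0 (g j) (hg0 j).ne', rfl⟩
  · refine IsKummer.closure ?_
    rintro _ ⟨j, rfl⟩
    refine ⟨(g j).den, (g j).den_pos, ?_⟩
    have hnum : ((g j).den : ℚ) * g j = ((g j).num.toNat : ℚ) := by
      rw [mul_comm, Rat.mul_den_eq_num]
      exact_mod_cast (Int.toNat_of_nonneg (Rat.num_nonneg.2 (hg0 j).le)).symm
    rw [← Nat.cast_smul_eq_nsmul ℚ, smul_smul, hnum, Nat.cast_smul_eq_nsmul]
    exact nsmul_mem (hpP j) _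
  · rintro N hPN ⟨v, hv, rfl⟩ hK
    have hvpos : ∀ i l, 0 ≤ b.repr (v i) l := by
      intro i l
      obtain ⟨k, hk, hkv⟩ := hK (v i) (AddSubmonoid.subset_closure ⟨i, rfl⟩)
      have := hpos _ hkv l
      rw [map_nsmul, Finsupp.smul_apply, nsmul_eq_mul] at this
      exact nonneg_of_mul_nonneg_right this (by exact_mod_cast hk)
    choose σ t ht hσ using fun j =>
      exists_eq_pos_smul_of_nonneg b v hv.ne_zero hvpos j (hPN (hpP j))
    have hσinj : Function.Injective σ := by
      intro j l hjl
      by_contra hne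
      have h1 : b.repr (v (σ j)) j = t j := by rw [hσ]; simp
      have h2 : b.repr (v (σ j)) j = 0 := by rw [hjl, hσ]; simp [Finsupp.single_eq_of_ne hne]
      exact (ht j).ne' (h1.symm.trans h2)
    have hσsurj : Function.Surjective σ := Finite.surjective_of_injective hσinj
    have hcoord : ∀ j, ∀ x ∈ AddSubmonoid.closure (Set.range v),
        b.repr x j ∈ Submodule.span ℤ {t j} := by
      intro j x hx
      induction hx using AddSubmonoid.closure_induction with
      | mem x hx =>
        obtain ⟨i, rfl⟩ := hx
        obtain ⟨l, rfl⟩ := hσsurj i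
        rw [hσ]
        rcases eq_or_ne j l with rfl | hne
        · simp
        · simp [Finsupp.single_eq_of_ne hne]
      | zero => simp
      | add x y _ _ hx hy =>
        rw [map_add, Finsupp.add_apply]
        exact add_mem hx hy
    rw [AddSubmonoid.closure_le]
    rintro _ ⟨j, rfl⟩
    have hle : Submodule.span ℤ ((b.coord j).toAddMonoidHom '' P) ≤ Submodule.span ℤ {t j} := by
      rw [Submodule.span_le]
      rintro _ ⟨x, hx, rfl⟩
      exact hcoord j x (hPN hx)
    rw [hg j] at hle
    obtain ⟨m, hm⟩ := Submodule.mem_span_singleton.1 (hle (Submodule.mem_span_singleton_self _))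
    have hm0 : 0 ≤ m := by
      have := (hg0 j).le
      rw [← hm, zsmul_eq_mul] at this
      exact_mod_cast nonneg_of_mul_nonneg_left this (ht j)
    lift m to ℕ using hm0
    change g j • b j ∈ _
    rw [← hm, smul_assoc, natCast_zsmul, ← hσ]
    exact nsmul_mem (AddSubmonoid.subset_closure (Set.mem_range_self (σ j))) m
end

section
/- Let P be a finitely generated additive submonoid of ℚ^d that is simplicial of full rank, with ℚ-linearly independent p_1, …, p_d ∈ P whose nonnegative rational span contains P, and let q_1, …, q_m be a finite generating set of P. Write q_i = Σ_j (a_{ij}/b_{ij})·p_j with a_{ij}, b_{ij} coprime natural numbers, b_{ij} ≥ 1 (these coefficients are uniquely determined by linear independence), and set c_j = lcm(b_{1j}, …, b_{mj}). Then the additive submonoid F of ℚ^d generated by p_1/c_1, …, p_d/c_d is free of rank d, contains P, and the extension P ⊆ F is Kummer: every element of F has a positive integer multiple lying in P. -/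
/-- If every generator of a commutative monoid extension has a positive multiple in `P`, then so
does every element of the extension. -/
theorem AddSubmonoid.exists_pos_nsmul_mem_of_mem_closure {M : Type*} [AddCommMonoid M]
    {P : AddSubmonoid M} {s : Set M} (hs : ∀ x ∈ s, ∃ k : ℕ, 0 < k ∧ k • x ∈ P)
    {x : M} (hx : x ∈ AddSubmonoid.closure s) : ∃ k : ℕ, 0 < k ∧ k • x ∈ P := by
  induction hx using AddSubmonoid.closure_induction with
  | mem x hx => exact hs x hx
  | zero => exact ⟨1, one_pos, by simp⟩
  | add x y _ _ ihx ihy =>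
    obtain ⟨k, hk, hkx⟩ := ihx
    obtain ⟨l, hl, hly⟩ := ihy
    refine ⟨k * l, Nat.mul_pos hk hl, ?_⟩
    rw [nsmul_add, mul_nsmul, mul_nsmul']
    exact P.add_mem (P.nsmul_mem hkx l) (P.nsmul_mem hly k)

/-- A fraction whose denominator divides `c` acts as a natural multiple of `c⁻¹`. -/
theorem div_smul_eq_nsmul_inv_smul {K V : Type*} [Field K] [CharZero K] [AddCommGroup V]
    [Module K V] {a b c : ℕ} (hc : c ≠ 0) (hbc : b ∣ c) (v : V) :
    ((a : K) / (b : K)) • v = (a * (c / b)) • ((c : K)⁻¹ • v) := by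
  obtain ⟨e, rfl⟩ := hbc
  have hb : b ≠ 0 := left_ne_zero_of_mul hc
  have he : (e : K) ≠ 0 := Nat.cast_ne_zero.mpr (right_ne_zero_of_mul hc)
  have hb' : (b : K) ≠ 0 := Nat.cast_ne_zero.mpr hb
  rw [Nat.mul_div_cancel_left e (Nat.pos_of_ne_zero hb), ← Nat.cast_smul_eq_nsmul K, smul_smul]
  congr 1
  push_cast
  field_simp


theorem stmt12 (d m : ℕ) (P : AddSubmonoid (Fin d → ℚ))
    -- P is simplicial of full rank, witnessed by p_1, …, p_d
    (p : Fin d → (Fin d → ℚ)) (hp : LinearIndependent ℚ p) (hpP : ∀ j, p j ∈ P)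
    (hspan : ∀ x ∈ P, ∃ c : Fin d → ℚ, (∀ j, 0 ≤ c j) ∧ x = ∑ j, c j • p j)
    -- q_1, …, q_m is a finite generating set of P
    (q : Fin m → (Fin d → ℚ)) (hq : P = AddSubmonoid.closure (Set.range q))
    -- q_i = Σ_j (a_{ij}/b_{ij}) p_j with a_{ij}, b_{ij} coprime, b_{ij} ≥ 1
    (a b : Fin m → Fin d → ℕ) (hb : ∀ i j, 1 ≤ b i j)
    (hcop : ∀ i j, Nat.Coprime (a i j) (b i j))
    (hrep : ∀ i, q i = ∑ j, (((a i j : ℚ)) / ((b i j : ℚ))) • p j) :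
    -- F := submonoid generated by p_1/c_1, …, p_d/c_d, with c_j = lcm_i b_{ij},
    -- is free of rank d, contains P, and the extension P ⊆ F is Kummer
    IsFreeRank d (AddSubmonoid.closure
        (Set.range fun j => (((Finset.univ.lcm fun i => b i j : ℕ) : ℚ))⁻¹ • p j)) ∧
    P ≤ AddSubmonoid.closure
        (Set.range fun j => (((Finset.univ.lcm fun i => b i j : ℕ) : ℚ))⁻¹ • p j) ∧
    IsKummer P (AddSubmonoid.closure
        (Set.range fun j => (((Finset.univ.lcm fun i => b i j : ℕ) : ℚ))⁻¹ • p j)) := by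
  have hc (j : Fin d) : (Finset.univ.lcm fun i => b i j) ≠ 0 := by
    rw [Ne, Finset.lcm_eq_zero_iff]
    rintro ⟨i, -, hi⟩
    exact (Nat.one_le_iff_ne_zero.mp (hb i j)) hi
  refine ⟨⟨_, ?_, rfl⟩, ?_, fun x hx => ?_⟩
  · exact hp.units_smul fun j => (Units.mk0 _ (Nat.cast_ne_zero.mpr (hc j)))⁻¹
  · rw [hq, AddSubmonoid.closure_le]
    rintro _ ⟨i, rfl⟩
    rw [SetLike.mem_coe, hrep i]
    refine AddSubmonoid.sum_mem _ fun j _ => ?_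
    rw [div_smul_eq_nsmul_inv_smul (hc j) (Finset.dvd_lcm (Finset.mem_univ i))]
    exact AddSubmonoid.nsmul_mem _ (AddSubmonoid.subset_closure (Set.mem_range_self j)) _
  · refine AddSubmonoid.exists_pos_nsmul_mem_of_mem_closure ?_ hx
    rintro _ ⟨j, rfl⟩
    refine ⟨_, Nat.pos_of_ne_zero (hc j), ?_⟩
    rw [← Nat.cast_smul_eq_nsmul ℚ, smul_inv_smul₀ (Nat.cast_ne_zero.mpr (hc j))]
    exact hpP j
end

section
/- Let P be a finitely generated additive submonoid of ℚ^d that is simplicial of full rank, with ℚ-linearly independent p_1, …, p_d ∈ P whose nonnegative rational span contains P. Let N be an additive submonoid of ℚ^d generated by a ℚ-linearly independent family e_1, …, e_d, such that P ⊆ N and every element of N has a positive integer multiple lying in P. Then there are a permutation σ of {1, …, d} and positive integers k_1, …, k_d such that e_{σ(j)} = p_j/k_j for every j. -/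
theorem exists_nat_sum_of_mem_closure_range {ι M : Type*} [Fintype ι] [AddCommMonoid M]
    (e : ι → M) {x : M} (hx : x ∈ AddSubmonoid.closure (Set.range e)) :
    ∃ a : ι → ℕ, x = ∑ i, a i • e i := by
  classical
  induction hx using AddSubmonoid.closure_induction with
  | mem x hx =>
    obtain ⟨i, rfl⟩ := hx
    exact ⟨Pi.single i 1, by simp [Pi.single_apply, ite_smul]⟩
  | zero => exact ⟨0, by simp⟩
  | add x y _ _ hx hy =>
    obtain ⟨a, rfl⟩ := hx
    obtain ⟨b, rfl⟩ := hy
    exact ⟨a + b, by simp [add_smul, Finset.sum_add_distrib]⟩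

/-- If two linearly independent families are nonnegative combinations of each other, then each
vector of the first is a multiple of one of the second, and these are matched bijectively. -/
theorem exists_perm_of_nonneg_combinations {ι V : Type*} [Fintype ι] [AddCommGroup V] [Module ℚ V]
    {p e : ι → V} (hp : LinearIndependent ℚ p) (he : LinearIndependent ℚ e)
    {A B : ι → ι → ℚ} (hA : ∀ j i, 0 ≤ A j i) (hB : ∀ i j, 0 ≤ B i j)
    (hpe : ∀ j, p j = ∑ i, A j i • e i) (hep : ∀ i, e i = ∑ j, B i j • p j) :
    ∃ σ : Equiv.Perm ι, ∀ j, 0 < A j (σ j) ∧ e (σ j) = (A j (σ j))⁻¹ • p j := by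
  classical
  have hAB : ∀ j k, ∑ i, A j i * B i k = if k = j then 1 else 0 := by
    intro j
    have h : ∑ k, (∑ i, A j i * B i k) • p k = ∑ k, (if k = j then (1 : ℚ) else 0) • p k := by
      simp only [Finset.sum_smul, ite_smul, one_smul, zero_smul, Finset.sum_ite_eq',
        Finset.mem_univ, if_true]
      rw [Finset.sum_comm]
      conv_rhs => rw [hpe j]
      refine Finset.sum_congr rfl fun i _ => ?_
      conv_rhs => rw [hep i]
      simp [Finset.smul_sum, mul_smul]
    exact Fintype.linearIndependent_iffₛ.mp hp _ _ h
  have hpos : ∀ j, ∃ i, 0 < A j i * B i j := by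
    intro j
    by_contra! h
    have h₁ := hAB j j
    have h₂ := Finset.sum_nonpos fun i (_ : i ∈ Finset.univ) => h i
    rw [if_pos rfl] at h₁
    linarith
  choose τ hτ using hpos
  have hApos : ∀ j, 0 < A j (τ j) := fun j => pos_of_mul_pos_left (hτ j) (hB _ _)
  have hBpos : ∀ j, 0 < B (τ j) j := fun j => pos_of_mul_pos_right (hτ j) (hA _ _)
  have hzero : ∀ j k, k ≠ j → B (τ j) k = 0 := by
    intro j k hk
    have h := hAB j k
    rw [if_neg hk, Finset.sum_eq_zero_iff_of_nonneg fun i _ => mul_nonneg (hA _ _) (hB _ _)] at h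
    exact (mul_eq_zero.mp (h (τ j) (Finset.mem_univ _))).resolve_left (hApos j).ne'
  have hinj : Function.Injective τ := by
    intro j k hjk
    by_contra hne
    have h := hBpos k
    rw [← hjk, hzero j k (Ne.symm hne)] at h
    exact h.false
  have hmul : ∀ j, e (τ j) = B (τ j) j • p j := by
    intro j
    conv_lhs => rw [hep]
    exact Finset.sum_eq_single j (fun k _ hk => by rw [hzero j k hk, zero_smul]) (by simp)
  have hone : ∀ j, B (τ j) j * A j (τ j) = 1 := by
    intro j
    have h : ∑ i, (B (τ j) j * A j i) • e i = ∑ i, (if i = τ j then (1 : ℚ) else 0) • e i := by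
      simp only [ite_smul, one_smul, zero_smul, Finset.sum_ite_eq', Finset.mem_univ, if_true,
        mul_smul, ← Finset.smul_sum, ← hpe, ← hmul]
    simpa using Fintype.linearIndependent_iffₛ.mp he _ _ h (τ j)
  refine ⟨Equiv.ofBijective τ (Finite.injective_iff_bijective.mp hinj), fun j => ?_⟩
  rw [Equiv.ofBijective_apply]
  exact ⟨hApos j, by rw [hmul j, eq_inv_of_mul_eq_one_left (hone j)]⟩

theorem stmt13 (d : ℕ) (P N : AddSubmonoid (Fin d → ℚ)) (hfg : P.FG)
    -- P is simplicial of full rank, witnessed by p_1, …, p_d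
    (p : Fin d → (Fin d → ℚ)) (hp : LinearIndependent ℚ p) (hpP : ∀ j, p j ∈ P)
    (hspan : ∀ x ∈ P, ∃ c : Fin d → ℚ, (∀ j, 0 ≤ c j) ∧ x = ∑ j, c j • p j)
    -- N is generated by a ℚ-linearly independent family e_1, …, e_d
    (e : Fin d → (Fin d → ℚ)) (he : LinearIndependent ℚ e)
    (hN : N = AddSubmonoid.closure (Set.range e))
    -- P ⊆ N and the extension is Kummer
    (hPN : P ≤ N) (hKum : ∀ x ∈ N, ∃ k : ℕ, 0 < k ∧ k • x ∈ P) :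
    -- then, up to a permutation, e_{σ(j)} = p_j / k_j for positive integers k_j
    ∃ σ : Equiv.Perm (Fin d), ∃ k : Fin d → ℕ, (∀ j, 0 < k j) ∧
      ∀ j, e (σ j) = ((k j : ℚ))⁻¹ • p j := by
  have hA : ∀ j, ∃ a : Fin d → ℕ, p j = ∑ i, a i • e i := fun j =>
    exists_nat_sum_of_mem_closure_range e (hN ▸ hPN (hpP j))
  have hB : ∀ i, ∃ b : Fin d → ℚ, (∀ j, 0 ≤ b j) ∧ e i = ∑ j, b j • p j := by
    intro i
    obtain ⟨k, hk, hkP⟩ := hKum (e i) (hN ▸ AddSubmonoid.subset_closure ⟨i, rfl⟩)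
    obtain ⟨c, hc, hce⟩ := hspan _ hkP
    have hk' : (k : ℚ) ≠ 0 := by exact_mod_cast hk.ne'
    refine ⟨fun j => (k : ℚ)⁻¹ * c j, fun j => mul_nonneg (by positivity) (hc j), ?_⟩
    simp only [mul_smul, ← Finset.smul_sum]
    rw [← hce, ← Nat.cast_smul_eq_nsmul ℚ, inv_smul_smul₀ hk']
  choose A hA using hA
  choose B hB hBe using hB
  obtain ⟨σ, hσ⟩ := exists_perm_of_nonneg_combinations hp he
    (A := fun j i => (A j i : ℚ)) (fun _ _ => Nat.cast_nonneg _) hB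
    (fun j => by simpa only [Nat.cast_smul_eq_nsmul] using hA j) hBe
  exact ⟨σ, fun j => A j (σ j), fun j => Nat.cast_pos.mp (hσ j).1, fun j => (hσ j).2⟩
end
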